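/- For every z in the upper half-plane ℍ: Φ16(x1(z),…,x6(z)) = 0. -/

import Mathlib

open Complex Finset

noncomputable section

/-- `ζ = exp(2πi/13)`. -/
def zeta13 : ℂ := Complex.exp (2 * Real.pi * Complex.I / 13)

local notation "ζ" => zeta13

/-- The diagonal matrix `T = diag(ζ^7, ζ^11, ζ^8, ζ^6, ζ^2, ζ^5)`. -/
def Tmat : Matrix (Fin 6) (Fin 6) ℂ :=
  Matrix.diagonal ![ζ ^ 7, ζ ^ 11, ζ ^ 8, ζ ^ 6, ζ ^ 2, ζ ^ 5]

/-- The matrix `S = -(1/√13)·M`. -/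
def Smat : Matrix (Fin 6) (Fin 6) ℂ :=
  (-(1 / (Real.sqrt 13 : ℂ))) • Matrix.of
    ![![ζ^12 - ζ, ζ^10 - ζ^3, ζ^4 - ζ^9, ζ^5 - ζ^8, ζ^2 - ζ^11, ζ^6 - ζ^7],
      ![ζ^10 - ζ^3, ζ^4 - ζ^9, ζ^12 - ζ, ζ^2 - ζ^11, ζ^6 - ζ^7, ζ^5 - ζ^8],
      ![ζ^4 - ζ^9, ζ^12 - ζ, ζ^10 - ζ^3, ζ^6 - ζ^7, ζ^5 - ζ^8, ζ^2 - ζ^11],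
      ![ζ^5 - ζ^8, ζ^2 - ζ^11, ζ^6 - ζ^7, ζ - ζ^12, ζ^3 - ζ^10, ζ^9 - ζ^4],
      ![ζ^2 - ζ^11, ζ^6 - ζ^7, ζ^5 - ζ^8, ζ^3 - ζ^10, ζ^9 - ζ^4, ζ - ζ^12],
      ![ζ^6 - ζ^7, ζ^5 - ζ^8, ζ^2 - ζ^11, ζ^9 - ζ^4, ζ - ζ^12, ζ^3 - ζ^10]]

/-- The matrix `H`, mapping `(z1,…,z6)` to `(z6, z4, z5, −z3, −z1, −z2)`. -/
def Hmat : Matrix (Fin 6) (Fin 6) ℂ :=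
  Matrix.of
    ![![0,0,0,0,0,1], ![0,0,0,1,0,0], ![0,0,0,0,1,0],
      ![0,0,-1,0,0,0], ![-1,0,0,0,0,0], ![0,-1,0,0,0,0]]

/-- The senary quadratic forms `A_0, …, A_6` (here `v 0 = z1, …, v 5 = z6`). -/
def A : ℕ → (Fin 6 → ℂ) → ℂ
  | 0, v => v 0 * v 3 + v 1 * v 4 + v 2 * v 5
  | 1, v => v 0 ^ 2 - 2 * v 2 * v 3
  | 2, v => -v 4 ^ 2 - 2 * v 1 * v 3
  | 3, v => v 1 ^ 2 - 2 * v 0 * v 4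
  | 4, v => v 2 ^ 2 - 2 * v 1 * v 5
  | 5, v => -v 3 ^ 2 - 2 * v 0 * v 5
  | 6, v => -v 5 ^ 2 - 2 * v 2 * v 4
  | _, _ => 0

/-- `w_ν = (A0 + ζ^ν A1 + ζ^{4ν} A2 + ζ^{9ν} A3 + ζ^{3ν} A4 + ζ^{12ν} A5 + ζ^{10ν} A6)^2`. -/
def w (ν : ℕ) (v : Fin 6 → ℂ) : ℂ :=
  (A 0 v + ζ ^ ν * A 1 v + ζ ^ (4 * ν) * A 2 v + ζ ^ (9 * ν) * A 3 v +
    ζ ^ (3 * ν) * A 4 v + ζ ^ (12 * ν) * A 5 v + ζ ^ (10 * ν) * A 6 v) ^ 2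

/-- `w_∞ = 13·A0^2`. -/
def winf (v : Fin 6 → ℂ) : ℂ := 13 * A 0 v ^ 2

/-- The senary cubic forms `D_0, …, D_12` (here `v 0 = z1, …, v 5 = z6`). -/
def D : ℕ → (Fin 6 → ℂ) → ℂ
  | 0, v => v 0 * v 1 * v 2
  | 1, v => 2 * v 1 * v 2 ^ 2 + v 1 ^ 2 * v 5 - v 3 ^ 2 * v 4 + v 0 * v 4 * v 5
  | 2, v => -v 5 ^ 3 + v 1 ^ 2 * v 3 - 2 * v 1 * v 4 ^ 2 + v 0 * v 3 * v 4 + 3 * v 2 * v 4 * v 5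
  | 3, v => 2 * v 0 * v 1 ^ 2 + v 0 ^ 2 * v 4 - v 3 * v 5 ^ 2 + v 2 * v 3 * v 4
  | 4, v => -v 1 ^ 2 * v 2 + v 0 * v 5 ^ 2 - 2 * v 3 ^ 2 * v 5 - v 0 * v 2 * v 4
  | 5, v => -v 3 ^ 3 + v 2 ^ 2 * v 4 - 2 * v 2 * v 5 ^ 2 + v 1 * v 4 * v 5 + 3 * v 0 * v 3 * v 5
  | 6, v => -v 4 ^ 3 + v 0 ^ 2 * v 5 - 2 * v 0 * v 3 ^ 2 + v 2 * v 3 * v 5 + 3 * v 1 * v 3 * v 4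
  | 7, v => -v 1 ^ 3 + v 2 * v 3 ^ 2 - v 0 * v 2 * v 5 - 3 * v 0 * v 1 * v 4 + 2 * v 0 ^ 2 * v 3
  | 8, v => -v 0 ^ 3 + v 1 * v 5 ^ 2 - v 1 * v 2 * v 4 - 3 * v 0 * v 2 * v 3 + 2 * v 2 ^ 2 * v 5
  | 9, v => 2 * v 0 ^ 2 * v 2 + v 2 ^ 2 * v 3 - v 4 ^ 2 * v 5 + v 1 * v 3 * v 5
  | 10, v => -v 0 * v 2 ^ 2 + v 1 * v 3 ^ 2 - 2 * v 3 * v 4 ^ 2 - v 0 * v 1 * v 5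
  | 11, v => -v 2 ^ 3 + v 0 * v 4 ^ 2 - v 0 * v 1 * v 3 - 3 * v 1 * v 2 * v 5 + 2 * v 1 ^ 2 * v 4
  | 12, v => -v 0 ^ 2 * v 1 + v 2 * v 4 ^ 2 - 2 * v 4 * v 5 ^ 2 - v 1 * v 2 * v 3
  | _, _ => 0

/-- The senary cubic form `D_∞ = z4 z5 z6`. -/
def Dinf (v : Fin 6 → ℂ) : ℂ := v 3 * v 4 * v 5

/-- The senary sextic forms `G_0, …, G_12`. -/
def Gs : ℕ → (Fin 6 → ℂ) → ℂ
  | 0, v => D 0 v ^ 2 + Dinf v ^ 2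
  | 1, v => -D 7 v ^ 2 + 2 * D 0 v * D 1 v + 10 * Dinf v * D 1 v + 2 * D 2 v * D 12 v
      - 2 * D 3 v * D 11 v - 4 * D 4 v * D 10 v - 2 * D 9 v * D 5 v
  | 2, v => -2 * D 1 v ^ 2 - 4 * D 0 v * D 2 v + 6 * Dinf v * D 2 v - 2 * D 4 v * D 11 v
      + 2 * D 5 v * D 10 v - 2 * D 6 v * D 9 v - 2 * D 7 v * D 8 v
  | 3, v => -D 8 v ^ 2 + 2 * D 0 v * D 3 v + 10 * Dinf v * D 3 v + 2 * D 6 v * D 10 v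
      - 2 * D 9 v * D 7 v - 4 * D 12 v * D 4 v - 2 * D 1 v * D 2 v
  | 4, v => -D 2 v ^ 2 + 10 * D 0 v * D 4 v - 2 * Dinf v * D 4 v + 2 * D 5 v * D 12 v
      - 2 * D 9 v * D 8 v - 4 * D 1 v * D 3 v - 2 * D 10 v * D 7 v
  | 5, v => -2 * D 9 v ^ 2 - 4 * D 0 v * D 5 v + 6 * Dinf v * D 5 v - 2 * D 10 v * D 8 v
      + 2 * D 6 v * D 12 v - 2 * D 2 v * D 3 v - 2 * D 11 v * D 7 v
  | 6, v => -2 * D 3 v ^ 2 - 4 * D 0 v * D 6 v + 6 * Dinf v * D 6 v - 2 * D 12 v * D 7 v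
      + 2 * D 2 v * D 4 v - 2 * D 5 v * D 1 v - 2 * D 8 v * D 11 v
  | 7, v => -2 * D 10 v ^ 2 + 6 * D 0 v * D 7 v + 4 * Dinf v * D 7 v - 2 * D 1 v * D 6 v
      - 2 * D 2 v * D 5 v - 2 * D 8 v * D 12 v - 2 * D 9 v * D 11 v
  | 8, v => -2 * D 4 v ^ 2 + 6 * D 0 v * D 8 v + 4 * Dinf v * D 8 v - 2 * D 3 v * D 5 v
      - 2 * D 6 v * D 2 v - 2 * D 11 v * D 10 v - 2 * D 1 v * D 7 v
  | 9, v => -D 11 v ^ 2 + 2 * D 0 v * D 9 v + 10 * Dinf v * D 9 v + 2 * D 5 v * D 4 v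
      - 2 * D 1 v * D 8 v - 4 * D 10 v * D 12 v - 2 * D 3 v * D 6 v
  | 10, v => -D 5 v ^ 2 + 10 * D 0 v * D 10 v - 2 * Dinf v * D 10 v + 2 * D 6 v * D 4 v
      - 2 * D 3 v * D 7 v - 4 * D 9 v * D 1 v - 2 * D 12 v * D 11 v
  | 11, v => -2 * D 12 v ^ 2 + 6 * D 0 v * D 11 v + 4 * Dinf v * D 11 v - 2 * D 9 v * D 2 v
      - 2 * D 5 v * D 6 v - 2 * D 7 v * D 4 v - 2 * D 3 v * D 8 v
  | 12, v => -D 6 v ^ 2 + 10 * D 0 v * D 12 v - 2 * Dinf v * D 12 v + 2 * D 2 v * D 10 v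
      - 2 * D 1 v * D 11 v - 4 * D 3 v * D 9 v - 2 * D 4 v * D 8 v
  | _, _ => 0

/-- `δ_ν = −13·G0 + Σ_{j=1}^{12} ζ^{jν} G_j`. -/
def deltaF (ν : ℕ) (v : Fin 6 → ℂ) : ℂ :=
  -13 * Gs 0 v + ∑ j ∈ Finset.Icc 1 12, ζ ^ (j * ν) * Gs j v

/-- `δ_∞ = 13^2·G0`. -/
def deltaInf (v : Fin 6 → ℂ) : ℂ := 13 ^ 2 * Gs 0 v

/-- `Φ4 = Σ_ν w_ν + w_∞`. -/
def Phi4 (v : Fin 6 → ℂ) : ℂ := (∑ ν ∈ Finset.range 13, w ν v) + winf v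

/-- `Φ8 = Σ_ν w_ν^2 + w_∞^2`. -/
def Phi8 (v : Fin 6 → ℂ) : ℂ := (∑ ν ∈ Finset.range 13, w ν v ^ 2) + winf v ^ 2

/-- `Φ12′ = −(1/(13·30))(Σ_ν w_ν^3 + w_∞^3)`. -/
def Phi12' (v : Fin 6 → ℂ) : ℂ :=
  -(1 / (13 * 30)) * ((∑ ν ∈ Finset.range 13, w ν v ^ 3) + winf v ^ 3)

/-- `Φ16 = Σ_ν w_ν^4 + w_∞^4`. -/
def Phi16 (v : Fin 6 → ℂ) : ℂ := (∑ ν ∈ Finset.range 13, w ν v ^ 4) + winf v ^ 4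

/-- `Φ20 = (1/(13·25))(Σ_ν w_ν^5 + w_∞^5)`. -/
def Phi20 (v : Fin 6 → ℂ) : ℂ :=
  (1 / (13 * 25)) * ((∑ ν ∈ Finset.range 13, w ν v ^ 5) + winf v ^ 5)

/-- `Φ12 = −(1/(13·52))(Σ_ν δ_ν^2 + δ_∞^2)`. -/
def Phi12 (v : Fin 6 → ℂ) : ℂ :=
  -(1 / (13 * 52)) * ((∑ ν ∈ Finset.range 13, deltaF ν v ^ 2) + deltaInf v ^ 2)

/-- `Φ18 = (1/(13·6))(Σ_ν δ_ν^3 + δ_∞^3)`. -/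
def Phi18 (v : Fin 6 → ℂ) : ℂ :=
  (1 / (13 * 6)) * ((∑ ν ∈ Finset.range 13, deltaF ν v ^ 3) + deltaInf v ^ 3)

/-- `Φ30 = −(1/(13·1315))(Σ_ν δ_ν^5 + δ_∞^5)`. -/
def Phi30 (v : Fin 6 → ℂ) : ℂ :=
  -(1 / (13 * 1315)) * ((∑ ν ∈ Finset.range 13, deltaF ν v ^ 5) + deltaInf v ^ 5)

/-- `q^α = exp(2πiαz)`. -/
def qp (α : ℚ) (z : ℂ) : ℂ := Complex.exp (2 * Real.pi * Complex.I * (α : ℂ) * z)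

/-- `Σ_{n∈ℤ} (−1)^n q^{(13n^2+cn)/2}`. -/
def thetaSum (c : ℤ) (z : ℂ) : ℂ :=
  ∑' n : ℤ, (-1 : ℂ) ^ n * qp ((13 * (n : ℚ) ^ 2 + (c : ℚ) * (n : ℚ)) / 2) z

/-- The theta constants of order 13: `a_1, …, a_6`. -/
def thc : ℕ → ℂ → ℂ
  | 1, z => qp (121 / 104) z * thetaSum 11 z
  | 2, z => qp (49 / 104) z * thetaSum 7 z
  | 3, z => qp (25 / 104) z * thetaSum 5 z
  | 4, z => -(qp (9 / 104) z * thetaSum 3 z)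
  | 5, z => qp (81 / 104) z * thetaSum 9 z
  | 6, z => qp (1 / 104) z * thetaSum 1 z
  | _, _ => 0

/-- The vector `A(z) = (a1(z), …, a6(z))`. -/
def Avec (z : ℂ) : Fin 6 → ℂ := fun i => thc (i.val + 1) z

/-- The Dedekind eta function `η(z) = q^{1/24} Π_{n=1}^∞ (1−q^n)`. -/
def etaF (z : ℂ) : ℂ :=
  qp (1 / 24) z * ∏' n : ℕ, (1 - Complex.exp (2 * Real.pi * Complex.I * z) ^ (n + 1))

/-- The vector `(x1(z), …, x6(z))` with `x_i(z) = η(z)·a_i(z)`. -/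
def X (z : ℂ) : Fin 6 → ℂ := fun i => etaF z * thc (i.val + 1) z

/-- The discriminant `Δ(z) = η(z)^24`. -/
def Delta (z : ℂ) : ℂ := etaF z ^ 24

/-- The Eisenstein series `E4(z) = (1/2) Σ_{gcd(m,n)=1} (mz+n)^{−4}`. -/
def E4 (z : ℂ) : ℂ :=
  (1 / 2) * ∑' p : {p : ℤ × ℤ // Int.gcd p.1 p.2 = 1},
    ((p.1.1 : ℂ) * z + (p.1.2 : ℂ)) ^ (-4 : ℤ)

/-- The Eisenstein series `E6(z) = (1/2) Σ_{gcd(m,n)=1} (mz+n)^{−6}`. -/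
def E6 (z : ℂ) : ℂ :=
  (1 / 2) * ∑' p : {p : ℤ × ℤ // Int.gcd p.1 p.2 = 1},
    ((p.1.1 : ℂ) * z + (p.1.2 : ℂ)) ^ (-6 : ℤ)

/-- The difference `ζ^k - ζ^(-k)`. -/
def sinDiff (k : ℕ) : ℂ := ζ ^ k - ζ ^ (13 - k)

/-- The sum `ζ^k + ζ^(-k)`. -/
def cosSum (k : ℕ) : ℂ := ζ ^ k + ζ ^ (13 - k)

/-- The quadratic Gauss sum modulo 13, whose square is 13. -/
def gauss13 : ℂ := 1 + 2 * (ζ + ζ ^ 3 + ζ ^ 4 + ζ ^ 9 + ζ ^ 10 + ζ ^ 12)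

/-- The linear map `-√13 · S`. -/
def mapS (v : Fin 6 → ℂ) : Fin 6 → ℂ :=
    ![-sinDiff 1 * v 0 - sinDiff 3 * v 1 + sinDiff 4 * v 2 + sinDiff 5 * v 3 + sinDiff 2 * v 4 +
      sinDiff 6 * v 5,
     -sinDiff 3 * v 0 + sinDiff 4 * v 1 - sinDiff 1 * v 2 + sinDiff 2 * v 3 + sinDiff 6 * v 4 +
      sinDiff 5 * v 5,
     sinDiff 4 * v 0 - sinDiff 1 * v 1 - sinDiff 3 * v 2 + sinDiff 6 * v 3 + sinDiff 5 * v 4 +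
      sinDiff 2 * v 5,
     sinDiff 5 * v 0 + sinDiff 2 * v 1 + sinDiff 6 * v 2 + sinDiff 1 * v 3 + sinDiff 3 * v 4 -
      sinDiff 4 * v 5,
     sinDiff 2 * v 0 + sinDiff 6 * v 1 + sinDiff 5 * v 2 + sinDiff 3 * v 3 - sinDiff 4 * v 4 +
      sinDiff 1 * v 5,
     sinDiff 6 * v 0 + sinDiff 5 * v 1 + sinDiff 2 * v 2 - sinDiff 4 * v 3 + sinDiff 1 * v 4 +
      sinDiff 3 * v 5]

/-- The quadratic forms with `w ν v = weilForm ν v ^ 2`, with exponents reduced modulo 13. -/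
def weilForm (ν : ℕ) (v : Fin 6 → ℂ) : ℂ :=
  A 0 v + ζ ^ (ν % 13) * A 1 v + ζ ^ (4 * ν % 13) * A 2 v + ζ ^ (9 * ν % 13) * A 3 v +
    ζ ^ (3 * ν % 13) * A 4 v + ζ ^ (12 * ν % 13) * A 5 v + ζ ^ (10 * ν % 13) * A 6 v

lemma zeta13_isPrimitiveRoot : IsPrimitiveRoot ζ 13 := by
  simpa [zeta13] using Complex.isPrimitiveRoot_exp 13 (by norm_num)

lemma zeta13_pow_thirteen : ζ ^ 13 = 1 := zeta13_isPrimitiveRoot.pow_eq_one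

lemma zeta13_geom_sum : 1 + ζ + ζ ^ 2 + ζ ^ 3 + ζ ^ 4 + ζ ^ 5 + ζ ^ 6 + ζ ^ 7 + ζ ^ 8 + ζ ^ 9 +
    ζ ^ 10 + ζ ^ 11 + ζ ^ 12 = 0 := by
  simpa [Finset.sum_range_succ] using zeta13_isPrimitiveRoot.geom_sum_eq_zero (by norm_num)

lemma zeta13_pow_mod (n : ℕ) : ζ ^ (n % 13) = ζ ^ n := (pow_eq_pow_mod n zeta13_pow_thirteen).symm

lemma w_eq_weilForm_sq (ν : ℕ) (v : Fin 6 → ℂ) : w ν v = weilForm ν v ^ 2 := by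
  simp only [w, weilForm, zeta13_pow_mod]

lemma gauss13_sq : gauss13 ^ 2 = 13 := by
  have h := zeta13_geom_sum
  rw [gauss13]
  generalize ζ = x at h ⊢
  grobner

lemma sinDiff_mul_sinDiff :
    sinDiff 1 * sinDiff 1 = -2 + cosSum 2 ∧ sinDiff 1 * sinDiff 2 = -cosSum 1 + cosSum 3 ∧
    sinDiff 1 * sinDiff 3 = -cosSum 2 + cosSum 4 ∧ sinDiff 1 * sinDiff 4 = -cosSum 3 + cosSum 5 ∧
    sinDiff 1 * sinDiff 5 = -cosSum 4 + cosSum 6 ∧ sinDiff 1 * sinDiff 6 = -cosSum 5 + cosSum 6 ∧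
    sinDiff 2 * sinDiff 2 = -2 + cosSum 4 ∧ sinDiff 2 * sinDiff 3 = -cosSum 1 + cosSum 5 ∧
    sinDiff 2 * sinDiff 4 = -cosSum 2 + cosSum 6 ∧ sinDiff 2 * sinDiff 5 = -cosSum 3 + cosSum 6 ∧
    sinDiff 2 * sinDiff 6 = -cosSum 4 + cosSum 5 ∧ sinDiff 3 * sinDiff 3 = -2 + cosSum 6 ∧
    sinDiff 3 * sinDiff 4 = -cosSum 1 + cosSum 6 ∧ sinDiff 3 * sinDiff 5 = -cosSum 2 + cosSum 5 ∧
    sinDiff 3 * sinDiff 6 = -cosSum 3 + cosSum 4 ∧ sinDiff 4 * sinDiff 4 = -2 + cosSum 5 ∧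
    sinDiff 4 * sinDiff 5 = -cosSum 1 + cosSum 4 ∧ sinDiff 4 * sinDiff 6 = -cosSum 2 + cosSum 3 ∧
    sinDiff 5 * sinDiff 5 = -2 + cosSum 3 ∧ sinDiff 5 * sinDiff 6 = -cosSum 1 + cosSum 2 ∧
    sinDiff 6 * sinDiff 6 = -2 + cosSum 1 := by
  have h := zeta13_pow_thirteen
  simp only [sinDiff, cosSum, Nat.reduceSub]
  generalize ζ = x at h ⊢
  and_intros <;> grobner

lemma gauss13_mul_cosSum :
    gauss13 = cosSum 1 - cosSum 2 + cosSum 3 + cosSum 4 - cosSum 5 - cosSum 6 ∧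
    gauss13 * cosSum 1 = 2 - cosSum 1 + 2 * cosSum 2 - 2 * cosSum 6 ∧
    gauss13 * cosSum 2 = -2 + 2 * cosSum 1 + cosSum 2 - 2 * cosSum 4 ∧
    gauss13 * cosSum 3 = 2 - cosSum 3 - 2 * cosSum 5 + 2 * cosSum 6 ∧
    gauss13 * cosSum 4 = 2 - 2 * cosSum 2 - cosSum 4 + 2 * cosSum 5 ∧
    gauss13 * cosSum 5 = -2 - 2 * cosSum 3 + 2 * cosSum 4 + cosSum 5 ∧
    gauss13 * cosSum 6 = -2 - 2 * cosSum 1 + 2 * cosSum 3 + cosSum 6 := by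
  have h := zeta13_geom_sum
  simp only [gauss13, cosSum, Nat.reduceSub]
  generalize ζ = x at h ⊢
  and_intros <;> grobner

lemma A_zero_mapS (v : Fin 6 → ℂ) :
    A 0 (mapS v) = gauss13 * (A 0 v + A 1 v + A 2 v + A 3 v + A 4 v + A 5 v + A 6 v) := by
  obtain ⟨h11, h12, h13, h14, h15, h16, h22, h23, h24, h25, h26, h33, h34, h35, h36, h44, h45, h46,
    h55, h56, h66⟩ := sinDiff_mul_sinDiff
  obtain ⟨g0, g1, g2, g3, g4, g5, g6⟩ := gauss13_mul_cosSum
  simp only [A, mapS, Matrix.cons_val]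
  linear_combination (norm := (simp only [A]; ring)) (-v 0 * v 3 - v 1 * v 4 - v 2 * v 5) * h11 +
    (-v 0 * v 1 - v 0 * v 2 - v 1 * v 2 + v 3 * v 4 + v 3 * v 5 + v 4 * v 5) * h12 + (-v 0 * v 4 -
    v 0 * v 5 - v 1 * v 3 - v 1 * v 5 - v 2 * v 3 - v 2 * v 4) * h13 + (v 0 * v 4 + v 0 * v 5 +
    v 1 * v 3 + v 1 * v 5 + v 2 * v 3 + v 2 * v 4) * h14 + (-v 0 ^ 2 - v 1 ^ 2 - v 2 ^ 2 + v 3 ^ 2 +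
    v 4 ^ 2 + v 5 ^ 2) * h15 + (-v 0 * v 1 - v 0 * v 2 - v 1 * v 2 + v 3 * v 4 + v 3 * v 5 +
    v 4 * v 5) * h16 + (v 0 * v 3 + v 1 * v 4 + v 2 * v 5) * h22 + (-v 0 ^ 2 - v 1 ^ 2 - v 2 ^ 2 +
    v 3 ^ 2 + v 4 ^ 2 + v 5 ^ 2) * h23 + (v 0 * v 1 + v 0 * v 2 + v 1 * v 2 - v 3 * v 4 - v 3 * v 5
    - v 4 * v 5) * h24 + (v 0 * v 4 + v 0 * v 5 + v 1 * v 3 + v 1 * v 5 + v 2 * v 3 +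
    v 2 * v 4) * h25 + (v 0 * v 4 + v 0 * v 5 + v 1 * v 3 + v 1 * v 5 + v 2 * v 3 + v 2 * v 4) * h26
    + (-v 0 * v 3 - v 1 * v 4 - v 2 * v 5) * h33 + (v 0 * v 4 + v 0 * v 5 + v 1 * v 3 + v 1 * v 5 +
    v 2 * v 3 + v 2 * v 4) * h34 + (-v 0 * v 1 - v 0 * v 2 - v 1 * v 2 + v 3 * v 4 + v 3 * v 5 +
    v 4 * v 5) * h35 + (-v 0 * v 1 - v 0 * v 2 - v 1 * v 2 + v 3 * v 4 + v 3 * v 5 +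
    v 4 * v 5) * h36 + (-v 0 * v 3 - v 1 * v 4 - v 2 * v 5) * h44 + (v 0 * v 1 + v 0 * v 2 +
    v 1 * v 2 - v 3 * v 4 - v 3 * v 5 - v 4 * v 5) * h45 + (v 0 ^ 2 + v 1 ^ 2 + v 2 ^ 2 - v 3 ^ 2 -
    v 4 ^ 2 - v 5 ^ 2) * h46 + (v 0 * v 3 + v 1 * v 4 + v 2 * v 5) * h55 + (v 0 * v 4 + v 0 * v 5 +
    v 1 * v 3 + v 1 * v 5 + v 2 * v 3 + v 2 * v 4) * h56 + (v 0 * v 3 + v 1 * v 4 + v 2 * v 5) * h66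
    + (-(A 0 v + A 1 v + A 2 v + A 3 v + A 4 v + A 5 v + A 6 v)) * g0

lemma A_one_mapS (v : Fin 6 → ℂ) :
    A 1 (mapS v) = gauss13 * (2 * A 0 v + cosSum 2 * A 1 v + cosSum 4 * A 2 v + cosSum 6 * A 3 v +
      cosSum 5 * A 4 v + cosSum 3 * A 5 v + cosSum 1 * A 6 v) := by
  obtain ⟨h11, h12, h13, h14, h15, h16, h22, h23, h24, h25, h26, h33, h34, h35, h36, h44, h45, h46,
    h55, h56, h66⟩ := sinDiff_mul_sinDiff
  obtain ⟨g0, g1, g2, g3, g4, g5, g6⟩ := gauss13_mul_cosSum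
  simp only [A, mapS, Matrix.cons_val]
  linear_combination (norm := (simp only [A]; ring)) (v 0 ^ 2 + 2 * v 1 * v 3) * h11 +
    (-2 * v 0 * v 4 + 2 * v 1 ^ 2 - 2 * v 3 * v 5) * h12 + (2 * v 0 * v 1 + 2 * v 1 * v 4 +
    2 * v 2 * v 3) * h13 + (-2 * v 0 * v 2 - 2 * v 0 * v 3 - 2 * v 1 * v 5) * h14 + (2 * v 0 * v 1 -
    2 * v 0 * v 3 - 2 * v 3 * v 4) * h15 + (-2 * v 0 * v 5 + 2 * v 1 * v 2 - 2 * v 3 ^ 2) * h16 +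
    (-2 * v 1 * v 5 + v 4 ^ 2) * h22 + (2 * v 1 * v 2 - 2 * v 1 * v 4 - 2 * v 4 * v 5) * h23 +
    (-2 * v 0 * v 1 + 2 * v 2 * v 4 + 2 * v 5 ^ 2) * h24 + (-2 * v 0 * v 5 - 2 * v 1 * v 4 +
    2 * v 3 * v 4) * h25 + (-2 * v 1 * v 3 - 2 * v 2 * v 5 + 2 * v 4 * v 5) * h26 + (v 1 ^ 2 +
    2 * v 2 * v 4) * h33 + (-2 * v 0 * v 4 - 2 * v 1 * v 2 - 2 * v 2 * v 5) * h34 + (2 * v 0 * v 2 -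
    2 * v 1 * v 3 - 2 * v 4 ^ 2) * h35 + (-2 * v 1 * v 5 + 2 * v 2 ^ 2 - 2 * v 3 * v 4) * h36 +
    (2 * v 0 * v 5 + v 2 ^ 2) * h44 + (-2 * v 0 ^ 2 + 2 * v 2 * v 3 + 2 * v 4 * v 5) * h45 +
    (-2 * v 0 * v 2 + 2 * v 2 * v 5 + 2 * v 3 * v 5) * h46 + (-2 * v 0 * v 4 + v 3 ^ 2) * h55 +
    (-2 * v 0 * v 3 - 2 * v 2 * v 4 + 2 * v 3 * v 5) * h56 + (-2 * v 2 * v 3 + v 5 ^ 2) * h66 +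
    (-2 * A 0 v) * g0 + (-A 1 v) * g2 + (-A 2 v) * g4 + (-A 3 v) * g6 + (-A 4 v) * g5 +
    (-A 5 v) * g3 + (-A 6 v) * g1

lemma A_two_mapS (v : Fin 6 → ℂ) :
    A 2 (mapS v) = gauss13 * (2 * A 0 v + cosSum 4 * A 1 v + cosSum 5 * A 2 v + cosSum 1 * A 3 v +
      cosSum 3 * A 4 v + cosSum 6 * A 5 v + cosSum 2 * A 6 v) := by
  obtain ⟨h11, h12, h13, h14, h15, h16, h22, h23, h24, h25, h26, h33, h34, h35, h36, h44, h45, h46,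
    h55, h56, h66⟩ := sinDiff_mul_sinDiff
  obtain ⟨g0, g1, g2, g3, g4, g5, g6⟩ := gauss13_mul_cosSum
  simp only [A, mapS, Matrix.cons_val]
  linear_combination (norm := (simp only [A]; ring)) (2 * v 2 * v 3 - v 5 ^ 2) * h11 +
    (-2 * v 0 * v 5 + 2 * v 1 * v 2 - 2 * v 3 ^ 2) * h12 + (2 * v 0 * v 3 + 2 * v 2 * v 4 -
    2 * v 3 * v 5) * h13 + (-2 * v 1 * v 3 - 2 * v 2 * v 5 + 2 * v 4 * v 5) * h14 + (2 * v 0 * v 2 -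
    2 * v 2 * v 5 - 2 * v 3 * v 5) * h15 + (-2 * v 1 * v 5 + 2 * v 2 ^ 2 - 2 * v 3 * v 4) * h16 +
    (-v 0 ^ 2 - 2 * v 1 * v 3) * h22 + (2 * v 0 * v 1 - 2 * v 0 * v 3 - 2 * v 3 * v 4) * h23 +
    (2 * v 0 * v 4 - 2 * v 1 ^ 2 + 2 * v 3 * v 5) * h24 + (-2 * v 0 * v 2 - 2 * v 0 * v 3 -
    2 * v 1 * v 5) * h25 + (-2 * v 0 * v 1 - 2 * v 1 * v 4 - 2 * v 2 * v 3) * h26 + (2 * v 0 * v 4 -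
    v 3 ^ 2) * h33 + (-2 * v 0 * v 5 - 2 * v 1 * v 4 + 2 * v 3 * v 4) * h34 + (2 * v 0 ^ 2 -
    2 * v 2 * v 3 - 2 * v 4 * v 5) * h35 + (2 * v 0 * v 2 - 2 * v 1 * v 3 - 2 * v 4 ^ 2) * h36 +
    (2 * v 1 * v 5 - v 4 ^ 2) * h44 + (-2 * v 0 * v 1 + 2 * v 2 * v 4 + 2 * v 5 ^ 2) * h45 +
    (-2 * v 1 * v 2 + 2 * v 1 * v 4 + 2 * v 4 * v 5) * h46 + (-2 * v 0 * v 5 - v 2 ^ 2) * h55 +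
    (-2 * v 0 * v 4 - 2 * v 1 * v 2 - 2 * v 2 * v 5) * h56 + (-v 1 ^ 2 - 2 * v 2 * v 4) * h66 +
    (-2 * A 0 v) * g0 + (-A 1 v) * g4 + (-A 2 v) * g5 + (-A 3 v) * g1 + (-A 4 v) * g3 +
    (-A 5 v) * g6 + (-A 6 v) * g2

/-- The cyclic symmetry `(z1, …, z6) ↦ (z2, z3, z1, z5, z6, z4)`. -/
def rot (v : Fin 6 → ℂ) : Fin 6 → ℂ := ![v 1, v 2, v 0, v 4, v 5, v 3]

lemma A_rot (v : Fin 6 → ℂ) : A 0 (rot v) = A 0 v ∧ A 1 (rot v) = A 3 v ∧ A 2 (rot v) = A 6 v ∧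
    A 3 (rot v) = A 4 v ∧ A 4 (rot v) = A 1 v ∧ A 5 (rot v) = A 2 v ∧ A 6 (rot v) = A 5 v := by
  simp only [A, rot, Matrix.cons_val, and_true]
  ring

lemma rot_mapS_rot (v : Fin 6 → ℂ) : rot (mapS (rot v)) = mapS v := by
  ext i
  fin_cases i <;> simp [rot, mapS] <;> ring

lemma A_four_mapS (v : Fin 6 → ℂ) :
    A 4 (mapS v) = gauss13 * (2 * A 0 v + cosSum 5 * A 1 v + cosSum 3 * A 2 v + cosSum 2 * A 3 v +
      cosSum 6 * A 4 v + cosSum 1 * A 5 v + cosSum 4 * A 6 v) := by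
  obtain ⟨h0, h1, h2, h3, h4, h5, h6⟩ := A_rot v
  rw [← rot_mapS_rot]
  obtain ⟨-, r1, r2, r3, r4, r5, r6⟩ := A_rot (mapS (rot v))
  rw [r4, A_one_mapS, h0, h1, h2, h3, h4, h5, h6]
  ring

lemma A_three_mapS (v : Fin 6 → ℂ) :
    A 3 (mapS v) = gauss13 * (2 * A 0 v + cosSum 6 * A 1 v + cosSum 1 * A 2 v + cosSum 5 * A 3 v +
      cosSum 2 * A 4 v + cosSum 4 * A 5 v + cosSum 3 * A 6 v) := by
  obtain ⟨h0, h1, h2, h3, h4, h5, h6⟩ := A_rot v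
  rw [← rot_mapS_rot]
  obtain ⟨-, r1, r2, r3, r4, r5, r6⟩ := A_rot (mapS (rot v))
  rw [r3, A_four_mapS, h0, h1, h2, h3, h4, h5, h6]
  ring

lemma A_five_mapS (v : Fin 6 → ℂ) :
    A 5 (mapS v) = gauss13 * (2 * A 0 v + cosSum 3 * A 1 v + cosSum 6 * A 2 v + cosSum 4 * A 3 v +
      cosSum 1 * A 4 v + cosSum 2 * A 5 v + cosSum 5 * A 6 v) := by
  obtain ⟨h0, h1, h2, h3, h4, h5, h6⟩ := A_rot v
  rw [← rot_mapS_rot]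
  obtain ⟨-, r1, r2, r3, r4, r5, r6⟩ := A_rot (mapS (rot v))
  rw [r5, A_two_mapS, h0, h1, h2, h3, h4, h5, h6]
  ring

lemma A_six_mapS (v : Fin 6 → ℂ) :
    A 6 (mapS v) = gauss13 * (2 * A 0 v + cosSum 1 * A 1 v + cosSum 2 * A 2 v + cosSum 3 * A 3 v +
      cosSum 4 * A 4 v + cosSum 5 * A 5 v + cosSum 6 * A 6 v) := by
  obtain ⟨h0, h1, h2, h3, h4, h5, h6⟩ := A_rot v
  rw [← rot_mapS_rot]
  obtain ⟨-, r1, r2, r3, r4, r5, r6⟩ := A_rot (mapS (rot v))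
  rw [r6, A_five_mapS, h0, h1, h2, h3, h4, h5, h6]
  ring

lemma weilForm_zero_mapS (v : Fin 6 → ℂ) :
    weilForm 0 (mapS v) = 13 * (gauss13 * A 0 v) := by
  have h := zeta13_geom_sum
  rw [weilForm, A_zero_mapS, A_one_mapS, A_two_mapS, A_three_mapS, A_four_mapS, A_five_mapS,
    A_six_mapS]
  simp only [cosSum, Nat.reduceSub, Nat.reduceMul, Nat.reduceMod]
  generalize ζ = x at h ⊢
  grobner

set_option maxRecDepth 20000 in
lemma weilForm_mapS (v : Fin 6 → ℂ) :
    weilForm 1 (mapS v) = 13 * weilForm 12 v ∧ weilForm 2 (mapS v) = -13 * weilForm 6 v ∧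
    weilForm 3 (mapS v) = 13 * weilForm 4 v ∧ weilForm 4 (mapS v) = 13 * weilForm 3 v ∧
    weilForm 5 (mapS v) = -13 * weilForm 5 v ∧ weilForm 6 (mapS v) = -13 * weilForm 2 v ∧
    weilForm 7 (mapS v) = -13 * weilForm 11 v ∧ weilForm 8 (mapS v) = -13 * weilForm 8 v ∧
    weilForm 9 (mapS v) = 13 * weilForm 10 v ∧ weilForm 10 (mapS v) = 13 * weilForm 9 v ∧
    weilForm 11 (mapS v) = -13 * weilForm 7 v ∧ weilForm 12 (mapS v) = 13 * weilForm 1 v := by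
  have h := zeta13_geom_sum
  have aux {x W : ℂ} (hx : x = gauss13 * (gauss13 * W)) : x = 13 * W := by
    rw [hx, ← gauss13_sq]
    ring
  have aux' {x W : ℂ} (hx : x = gauss13 * (-gauss13 * W)) : x = -13 * W := by
    rw [hx, ← gauss13_sq]
    ring
  refine ⟨aux ?_, aux' ?_, aux ?_, aux ?_, aux' ?_, aux' ?_, aux' ?_, aux' ?_, aux ?_, aux ?_,
    aux' ?_, aux ?_⟩
  all_goals
    rw [weilForm, A_zero_mapS, A_one_mapS, A_two_mapS, A_three_mapS, A_four_mapS, A_five_mapS,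
      A_six_mapS]
    simp only [mul_left_comm _ gauss13, ← mul_add]
    congr 1
    simp only [weilForm, cosSum, Nat.reduceSub, Nat.reduceMul, Nat.reduceMod, gauss13]
    generalize ζ = x at h ⊢
    grobner

lemma Phi16_mapS (v : Fin 6 → ℂ) : Phi16 (mapS v) = 13 ^ 8 * Phi16 v := by
  obtain ⟨h1, h2, h3, h4, h5, h6, h7, h8, h9, h10, h11, h12⟩ := weilForm_mapS v
  have hinf : winf (mapS v) = 169 * weilForm 0 v ^ 2 := by
    simp only [winf, A_zero_mapS, weilForm, Nat.reduceMul, Nat.reduceMod, pow_zero, one_mul]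
    linear_combination
      13 * (A 0 v + A 1 v + A 2 v + A 3 v + A 4 v + A 5 v + A 6 v) ^ 2 * gauss13_sq
  have hg : gauss13 ^ 8 = 13 ^ 4 := by rw [← gauss13_sq]; ring
  simp only [Phi16, Finset.sum_range_succ, Finset.sum_range_zero, w_eq_weilForm_sq, hinf, h1, h2,
    h3, h4, h5, h6, h7, h8, h9, h10, h11, h12, weilForm_zero_mapS]
  rw [winf]
  linear_combination 13 ^ 8 * A 0 v ^ 8 * hg

/-- The theta constant `Σ (-1)^n q^{(26n+c)²/104}`. -/
def thetaConst (c : ℤ) (z : ℂ) : ℂ :=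
  ∑' n : ℤ, cexp (Real.pi * I * n + Real.pi * I * z * (26 * n + c) ^ 2 / 52)

lemma qp_mul_thetaSum (c : ℤ) (z : ℂ) :
    qp ((c : ℚ) ^ 2 / 104) z * thetaSum c z = thetaConst c z := by
  rw [thetaSum, thetaConst, ← tsum_mul_left]
  refine tsum_congr fun n ↦ ?_
  rw [← Complex.exp_pi_mul_I, ← Complex.exp_int_mul, qp, qp, ← Complex.exp_add, ← Complex.exp_add]
  congr 1
  push_cast
  ring

lemma Avec_eq_thetaConst (z : ℂ) :
    Avec z = ![thetaConst 11 z, thetaConst 7 z, thetaConst 5 z, -thetaConst 3 z, thetaConst 9 z,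
      thetaConst 1 z] := by
  ext i
  fin_cases i <;> simp [Avec, thc, ← qp_mul_thetaSum] <;> norm_num

lemma thetaConst_term_eq (c n : ℤ) (z : ℂ) :
    cexp (Real.pi * I * n + Real.pi * I * z * (26 * n + c) ^ 2 / 52) =
      cexp (Real.pi * I * c ^ 2 * z / 52) * jacobiTheta₂_term n (1 / 2 + c * z / 2) (13 * z) := by
  rw [jacobiTheta₂_term, ← Complex.exp_add]
  congr 1
  ring

lemma thetaConst_eq_jacobiTheta₂ (c : ℤ) (z : ℂ) :
    thetaConst c z =
      cexp (Real.pi * I * c ^ 2 * z / 52) * jacobiTheta₂ (1 / 2 + c * z / 2) (13 * z) := by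
  simp only [thetaConst, thetaConst_term_eq, tsum_mul_left, jacobiTheta₂]

lemma summable_thetaConst (c : ℤ) {z : ℂ} (hz : 0 < z.im) :
    Summable fun n : ℤ ↦ cexp (Real.pi * I * n + Real.pi * I * z * (26 * n + c) ^ 2 / 52) := by
  simp only [thetaConst_term_eq]
  exact ((summable_jacobiTheta₂_term_iff _ _).mpr (by simpa)).mul_left _

lemma differentiableAt_thetaConst (c : ℤ) {z : ℂ} (hz : 0 < z.im) :
    DifferentiableAt ℂ (thetaConst c) z := by
  simp only [funext (thetaConst_eq_jacobiTheta₂ c)]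
  refine DifferentiableAt.mul (by fun_prop) ?_
  have h := (hasFDerivAt_jacobiTheta₂ (1 / 2 + c * z / 2) (τ := 13 * z)
    (by simpa)).differentiableAt
  exact h.comp (f := fun z : ℂ ↦ (1 / 2 + c * z / 2, 13 * z)) z (by fun_prop)

lemma thetaConst_neg (c : ℤ) (z : ℂ) : thetaConst (-c) z = thetaConst c z := by
  rw [thetaConst, ← (Equiv.neg ℤ).tsum_eq]
  refine tsum_congr fun n ↦ Complex.exp_eq_exp_iff_exists_int.mpr ⟨-n, ?_⟩
  simp only [Equiv.neg_apply]
  push_cast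
  ring

lemma thetaConst_neg_thirteen (z : ℂ) : thetaConst (-13) z = 0 := by
  suffices h : thetaConst (-13) z = -thetaConst (-13) z from self_eq_neg.mp h
  conv_lhs => rw [thetaConst, ← (Equiv.subLeft (1 : ℤ)).tsum_eq]
  rw [thetaConst, ← tsum_neg]
  refine tsum_congr fun n ↦ ?_
  rw [← neg_one_mul (cexp _), ← Complex.exp_pi_mul_I, ← Complex.exp_add]
  refine Complex.exp_eq_exp_iff_exists_int.mpr ⟨-n, ?_⟩
  simp only [Equiv.subLeft_apply]
  push_cast
  ring

lemma thetaConst_add_one {c : ℤ} (hc : Odd c) (z : ℂ) :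
    thetaConst c (z + 1) = cexp (Real.pi * I * c ^ 2 / 52) * thetaConst c z := by
  rw [thetaConst, thetaConst, ← tsum_mul_left]
  refine tsum_congr fun n ↦ ?_
  obtain ⟨m, hm⟩ : Even (13 * n ^ 2 + c * n) := by
    rcases Int.even_or_odd n with hn | hn
    · exact ((hn.pow_of_ne_zero two_ne_zero).mul_left 13).add (hn.mul_left c)
    · exact Odd.add_odd (Odd.mul (by decide) hn.pow) (hc.mul hn)
  rw [← Complex.exp_add]
  refine Complex.exp_eq_exp_iff_exists_int.mpr ⟨m, ?_⟩
  have hm' : (13 * n ^ 2 + c * n : ℂ) = m + m := mod_cast hm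
  linear_combination Real.pi * I * hm'

lemma tsum_int_eq_sum_tsum {f : ℤ → ℂ} (hf : Summable f) (N : ℕ) [NeZero N] :
    ∑' n, f n = ∑ r : Fin N, ∑' k : ℤ, f (k * N + r) := by
  let e : Fin N × ℤ ≃ ℤ := (Equiv.prodComm _ _).trans (Int.divModEquiv N).symm
  have h : Summable fun p : Fin N × ℤ ↦ f (e p) := hf.comp_injective e.injective
  rw [← e.tsum_eq f, h.tsum_prod, tsum_fintype]
  simp [e]

lemma thetaConst_neg_inv {c : ℤ} (hc : Odd c) {z : ℂ} (hz : 0 < z.im) :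
    thetaConst c (-z⁻¹) = 1 / (13 * I / z) ^ (1 / 2 : ℂ) *
      ∑ r : Fin 13, cexp (Real.pi * I * c * (2 * r - 13) / 26) * thetaConst (2 * r - 13) z := by
  have hz0 : z ≠ 0 := by rintro rfl; simp at hz
  set g : ℤ → ℂ := fun n ↦ cexp (Real.pi * I * c * (2 * n - 1) / 26 +
        Real.pi * I * z * (2 * n - 1) ^ 2 / 52) with hg
  have hgt (n : ℤ) : g n = cexp (Real.pi * I * z / 52 - Real.pi * I * c / 26) *
      jacobiTheta₂_term n ((c - z) / 26) (z / 13) := by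
    simp only [hg, jacobiTheta₂_term, ← Complex.exp_add]
    congr 1
    ring
  have hsum : Summable g := by
    simp only [funext hgt]
    exact ((summable_jacobiTheta₂_term_iff _ _).mpr (by simpa)).mul_left _
  have key : thetaConst c (-z⁻¹) = 1 / (13 * I / z) ^ (1 / 2 : ℂ) * ∑' n : ℤ, g n := by
    simp only [hgt, tsum_mul_left]
    rw [thetaConst_eq_jacobiTheta₂, jacobiTheta₂_functional_equation, mul_left_comm, mul_assoc,
      mul_assoc, ← mul_assoc (cexp _), ← Complex.exp_add]
    congr 2
    · congr 1
      ring
    · congr 1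
      field_simp
      ring
    · rw [jacobiTheta₂]
      refine tsum_congr fun n ↦ ?_
      congr 1
      · field_simp
        ring
      · field_simp
  rw [key, ← (Equiv.addRight (-6 : ℤ)).tsum_eq g, tsum_int_eq_sum_tsum (N := 13) (by
    simpa [Function.comp_def] using hsum.comp_injective (Equiv.addRight (-6 : ℤ)).injective)]
  refine congrArg _ (Finset.sum_congr rfl fun r _ ↦ ?_)
  rw [thetaConst, ← tsum_mul_left]
  refine tsum_congr fun k ↦ ?_
  simp only [hg, ← Complex.exp_add]
  obtain ⟨m, rfl⟩ := hc
  refine Complex.exp_eq_exp_iff_exists_int.mpr ⟨m * k, ?_⟩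
  simp only [Equiv.coe_addRight]
  push_cast
  ring

lemma Phi16_smul (c : ℂ) (v : Fin 6 → ℂ) : Phi16 (c • v) = c ^ 16 * Phi16 v := by
  have hw (ν : ℕ) : w ν (c • v) = c ^ 4 * w ν v := by
    simp only [w, A, Pi.smul_apply, smul_eq_mul]
    ring
  have hinf : winf (c • v) = c ^ 4 * winf v := by
    simp only [winf, A, Pi.smul_apply, smul_eq_mul]
    ring
  simp only [Phi16, hw, hinf, mul_pow, ← Finset.mul_sum]
  ring

lemma cexp_pi_mul_I_div_fiftyTwo_pow_eight : cexp (Real.pi * I / 52) ^ 8 = ζ := by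
  rw [zeta13, ← Complex.exp_nat_mul]
  congr 1
  push_cast
  ring

lemma Avec_add_one (z : ℂ) :
    Avec (z + 1) = cexp (Real.pi * I / 52) •
      ![ζ ^ 2 * Avec z 0, ζ ^ 6 * Avec z 1, ζ ^ 3 * Avec z 2, ζ * Avec z 3, ζ ^ 10 * Avec z 4,
        Avec z 5] := by
  have key {c k : ℕ} (hc : c ^ 2 = 8 * k + 1) :
      thetaConst c (z + 1) = cexp (Real.pi * I / 52) * (ζ ^ k * thetaConst c z) := by
    have hc' : Odd c := by
      rw [← Nat.odd_pow_iff two_ne_zero, hc]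
      exact ⟨4 * k, by ring⟩
    have h : ((c : ℂ) ^ 2) = 8 * k + 1 := mod_cast hc
    rw [thetaConst_add_one (mod_cast hc'), ← cexp_pi_mul_I_div_fiftyTwo_pow_eight, ← pow_mul,
      ← mul_assoc, ← pow_succ', ← Complex.exp_nat_mul]
    congr 2
    push_cast
    linear_combination Real.pi * I / 52 * h
  have h11 := key (c := 11) (k := 15) (by norm_num)
  have h7 := key (c := 7) (k := 6) (by norm_num)
  have h5 := key (c := 5) (k := 3) (by norm_num)
  have h3 := key (c := 3) (k := 1) (by norm_num)
  have h9 := key (c := 9) (k := 10) (by norm_num)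
  have h1 := key (c := 1) (k := 0) (by norm_num)
  rw [← zeta13_pow_mod] at h11
  push_cast at h11 h7 h5 h3 h9 h1
  rw [Avec_eq_thetaConst, h11, h7, h5, h3, h9, h1, Avec_eq_thetaConst]
  ext i
  fin_cases i <;> simp

lemma Phi16_diagonal (v : Fin 6 → ℂ) :
    Phi16 ![ζ ^ 2 * v 0, ζ ^ 6 * v 1, ζ ^ 3 * v 2, ζ * v 3, ζ ^ 10 * v 4, v 5] =
      ζ ^ 24 * Phi16 v := by
  have h := zeta13_pow_thirteen
  have hA : A 0 ![ζ ^ 2 * v 0, ζ ^ 6 * v 1, ζ ^ 3 * v 2, ζ * v 3, ζ ^ 10 * v 4, v 5] =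
        ζ ^ 3 * A 0 v ∧
      A 1 ![ζ ^ 2 * v 0, ζ ^ 6 * v 1, ζ ^ 3 * v 2, ζ * v 3, ζ ^ 10 * v 4, v 5] = ζ ^ 4 * A 1 v ∧
      A 2 ![ζ ^ 2 * v 0, ζ ^ 6 * v 1, ζ ^ 3 * v 2, ζ * v 3, ζ ^ 10 * v 4, v 5] = ζ ^ 7 * A 2 v ∧
      A 3 ![ζ ^ 2 * v 0, ζ ^ 6 * v 1, ζ ^ 3 * v 2, ζ * v 3, ζ ^ 10 * v 4, v 5] = ζ ^ 12 * A 3 v ∧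
      A 4 ![ζ ^ 2 * v 0, ζ ^ 6 * v 1, ζ ^ 3 * v 2, ζ * v 3, ζ ^ 10 * v 4, v 5] = ζ ^ 6 * A 4 v ∧
      A 5 ![ζ ^ 2 * v 0, ζ ^ 6 * v 1, ζ ^ 3 * v 2, ζ * v 3, ζ ^ 10 * v 4, v 5] = ζ ^ 15 * A 5 v ∧
      A 6 ![ζ ^ 2 * v 0, ζ ^ 6 * v 1, ζ ^ 3 * v 2, ζ * v 3, ζ ^ 10 * v 4, v 5] = ζ ^ 13 * A 6 v := by
    simp only [A, Matrix.cons_val]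
    generalize ζ = x at h ⊢
    refine ⟨?_, ?_, ?_, ?_, ?_, ?_, ?_⟩ <;> grobner
  obtain ⟨h0, h1, h2, h3, h4, h5, h6⟩ := hA
  have hw (ν : ℕ) : w ν ![ζ ^ 2 * v 0, ζ ^ 6 * v 1, ζ ^ 3 * v 2, ζ * v 3, ζ ^ 10 * v 4, v 5] =
      ζ ^ 6 * w (ν + 1) v := by
    simp only [w, h0, h1, h2, h3, h4, h5, h6]
    ring
  have hinf : winf ![ζ ^ 2 * v 0, ζ ^ 6 * v 1, ζ ^ 3 * v 2, ζ * v 3, ζ ^ 10 * v 4, v 5] =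
      ζ ^ 6 * winf v := by
    simp only [winf, h0]
    ring
  have hper : w 13 v = w 0 v := by
    simp only [w_eq_weilForm_sq, weilForm, Nat.reduceMul, Nat.reduceMod]
  have hsum : ∑ ν ∈ Finset.range 13, w (ν + 1) v ^ 4 = ∑ ν ∈ Finset.range 13, w ν v ^ 4 := by
    have h1 := Finset.sum_range_succ' (fun ν ↦ w ν v ^ 4) 13
    rw [Finset.sum_range_succ, hper] at h1
    exact (add_right_cancel h1).symm
  simp only [Phi16, hw, hinf, mul_pow, ← Finset.mul_sum, hsum]
  ring

lemma Phi16_Avec_add_one (z : ℂ) : Phi16 (Avec (z + 1)) = Phi16 (Avec z) := by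
  rw [Avec_add_one, Phi16_smul, Phi16_diagonal, ← mul_assoc,
    show 16 = 8 * 2 by rfl, pow_mul, cexp_pi_mul_I_div_fiftyTwo_pow_eight, ← pow_add,
    ← zeta13_pow_mod]
  simp

lemma thetaConst_neg_inv_eq_sum {c : ℕ} (hc : Odd c) {z : ℂ} (hz : 0 < z.im) :
    thetaConst c (-z⁻¹) = 1 / (13 * I / z) ^ (1 / 2 : ℂ) *
      ∑ k ∈ Finset.range 6, I ^ (c * (2 * k + 1) % 4) *
        (ζ ^ (10 * (c * (2 * k + 1)) % 13) - ζ ^ (3 * (c * (2 * k + 1)) % 13)) *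
          thetaConst (2 * k + 1) z := by
  have hx : cexp (Real.pi * I / 26) = I * ζ ^ 10 := by
    have h : cexp (Real.pi * I / 26) =
        cexp (Real.pi / 2 * I) * cexp ((10 : ℕ) * (2 * Real.pi * I / 13)) := by
      rw [← Complex.exp_add]
      refine Complex.exp_eq_exp_iff_exists_int.mpr ⟨-1, ?_⟩
      push_cast
      ring
    rw [h, Complex.exp_pi_div_two_mul_I, Complex.exp_nat_mul, zeta13]
  have hx' : cexp (-(Real.pi * I / 26)) = -(I * ζ ^ 3) := by
    rw [Complex.exp_neg, hx, inv_eq_iff_eq_inv]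
    refine eq_inv_of_mul_eq_one_left ?_
    linear_combination -ζ ^ 13 * I_sq + zeta13_pow_thirteen
  have key (k : ℕ) : cexp (Real.pi * I * c * (2 * k + 1) / 26) +
      cexp (-(Real.pi * I * c * (2 * k + 1) / 26)) = I ^ (c * (2 * k + 1) % 4) *
        (ζ ^ (10 * (c * (2 * k + 1)) % 13) - ζ ^ (3 * (c * (2 * k + 1)) % 13)) := by
    have hm : Odd (c * (2 * k + 1)) := hc.mul ⟨k, rfl⟩
    rw [zeta13_pow_mod, zeta13_pow_mod, ← pow_eq_pow_mod _ I_pow_four, pow_mul ζ, pow_mul ζ, mul_sub,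
      ← mul_pow, ← mul_pow, ← hx, sub_eq_add_neg, ← hm.neg_pow, ← hx', ← Complex.exp_nat_mul,
      ← Complex.exp_nat_mul]
    congr 2 <;> (push_cast; ring)
  have hsum : ∑ r : Fin 13,
      cexp (Real.pi * I * c * (2 * r - 13) / 26) * thetaConst (2 * r - 13) z =
        ∑ k ∈ Finset.range 6, (cexp (Real.pi * I * c * (2 * k + 1) / 26) +
          cexp (-(Real.pi * I * c * (2 * k + 1) / 26))) * thetaConst (2 * k + 1) z := by
    have hf (f : ℕ → ℂ) : ∑ r ∈ Finset.range 13, f r =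
        f 0 + ∑ k ∈ Finset.range 6, (f (7 + k) + f (6 - k)) := by
      simp only [Finset.sum_range_succ, Finset.sum_range_zero, Nat.reduceAdd, Nat.reduceSub]
      ring
    rw [Fin.sum_univ_eq_sum_range (fun r : ℕ ↦ cexp (Real.pi * I * c * (2 * r - 13) / 26) *
      thetaConst (2 * r - 13) z), hf]
    simp only [Nat.cast_zero, mul_zero, zero_sub, thetaConst_neg_thirteen, zero_add]
    refine Finset.sum_congr rfl fun k hk ↦ ?_
    rw [Finset.mem_range] at hk
    rw [Nat.cast_sub (by lia), Nat.cast_sub (by lia),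
      show (2 * ((6 : ℕ) - k) - 13 : ℤ) = -(2 * k + 1) by push_cast; ring, thetaConst_neg, add_mul]
    push_cast
    congr 3 <;> ring
  rw [thetaConst_neg_inv (mod_cast hc) hz]
  simp only [Int.cast_natCast, hsum, key]

lemma Avec_neg_inv {z : ℂ} (hz : 0 < z.im) :
    Avec (-z⁻¹) = (-I / (13 * I / z) ^ (1 / 2 : ℂ)) • mapS (Avec z) := by
  have h11 := thetaConst_neg_inv_eq_sum (c := 11) (by decide) hz
  have h7 := thetaConst_neg_inv_eq_sum (c := 7) (by decide) hz
  have h5 := thetaConst_neg_inv_eq_sum (c := 5) (by decide) hz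
  have h3 := thetaConst_neg_inv_eq_sum (c := 3) (by decide) hz
  have h9 := thetaConst_neg_inv_eq_sum (c := 9) (by decide) hz
  have h1 := thetaConst_neg_inv_eq_sum (c := 1) (by decide) hz
  simp [Finset.sum_range_succ] at h11 h7 h5 h3 h9 h1
  rw [Avec_eq_thetaConst, h11, h7, h5, h3, h9, h1, Avec_eq_thetaConst]
  ext i
  fin_cases i <;> simp [mapS, sinDiff] <;> ring

lemma Phi16_Avec_neg_inv {z : ℂ} (hz : 0 < z.im) :
    Phi16 (Avec (-z⁻¹)) = z ^ 8 * Phi16 (Avec z) := by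
  have hz0 : z ≠ 0 := by rintro rfl; simp at hz
  rw [Avec_neg_inv hz, Phi16_smul, Phi16_mapS, ← mul_assoc]
  congr 1
  have h : ((13 * I / z) ^ (1 / 2 : ℂ)) ^ 2 = 13 * I / z := by
    rw [one_div]
    exact Complex.cpow_ofNat_inv_pow _ _
  rw [div_pow, show 16 = 2 * 8 by rfl, pow_mul (_ ^ (1 / 2 : ℂ)), h, div_pow, mul_pow]
  rw [show (I : ℂ) ^ 8 = 1 by rw [show 8 = 4 * 2 by rfl, pow_mul, I_pow_four, one_pow], pow_mul]
  field_simp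
  simp

lemma continuous_Phi16 : Continuous Phi16 := by
  unfold Phi16 w winf
  simp only [A]
  fun_prop

lemma differentiable_Phi16 : Differentiable ℂ Phi16 := by
  unfold Phi16 w winf
  simp only [A]
  fun_prop

lemma differentiableAt_Avec {z : ℂ} (hz : 0 < z.im) : DifferentiableAt ℂ Avec z := by
  rw [funext Avec_eq_thetaConst, differentiableAt_pi]
  have h (c : ℤ) := differentiableAt_thetaConst c hz
  intro i
  fin_cases i
  exacts [h 11, h 7, h 5, (h 3).neg, h 9, h 1]

open scoped UpperHalfPlane in
lemma tendsto_thetaConst_atImInfty {c : ℤ} (hc : Odd c) :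
    Filter.Tendsto (fun τ : ℍ ↦ thetaConst c τ) UpperHalfPlane.atImInfty (nhds 0) := by
  have hnorm (n : ℤ) (z : ℂ) :
      ‖cexp (Real.pi * I * n + Real.pi * I * z * (26 * n + c) ^ 2 / 52)‖ =
        Real.exp (-(Real.pi * (26 * n + c) ^ 2 / 52) * z.im) := by
    rw [Complex.norm_exp]
    congr 1
    have h : Real.pi * I * n + Real.pi * I * z * (26 * n + c) ^ 2 / 52 =
        ((Real.pi * n : ℝ) : ℂ) * I +
          ((Real.pi * (26 * n + c) ^ 2 / 52 : ℝ) : ℂ) * (z * I) := by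
      push_cast
      ring
    rw [h, add_re, re_ofReal_mul, re_ofReal_mul, I_re, mul_I_re]
    ring
  have h0 : ∑' _ : ℤ, (0 : ℂ) = 0 := tsum_zero
  rw [← h0]
  refine tendsto_tsum_of_dominated_convergence
    (bound := fun n : ℤ ↦ ‖cexp (Real.pi * I * n + Real.pi * I * I * (26 * n + c) ^ 2 / 52)‖)
    (summable_thetaConst c (z := I) (by simp)).norm (fun n ↦ ?_) ?_
  · rw [tendsto_zero_iff_norm_tendsto_zero]
    simp only [hnorm]
    refine Real.tendsto_exp_atBot.comp
      (Filter.Tendsto.const_mul_atTop_of_neg ?_ Filter.tendsto_comap)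
    have hne : (26 * n + c : ℝ) ≠ 0 := by
      have : 26 * n + c ≠ 0 := by
        obtain ⟨m, rfl⟩ := hc
        lia
      exact_mod_cast this
    have := Real.pi_pos
    rw [neg_lt_zero]
    positivity
  · filter_upwards [Filter.preimage_mem_comap (Filter.Ici_mem_atTop (1 : ℝ))] with τ hτ n
    rw [hnorm, hnorm, Real.exp_le_exp, I_im]
    have := Real.pi_pos
    exact mul_le_mul_of_nonpos_left hτ (neg_nonpos.mpr (by positivity))

open scoped UpperHalfPlane in
lemma isZeroAtImInfty_Phi16_Avec :
    UpperHalfPlane.IsZeroAtImInfty fun τ : ℍ ↦ Phi16 (Avec τ) := by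
  have h : Filter.Tendsto (fun τ : ℍ ↦ Avec τ) UpperHalfPlane.atImInfty (nhds 0) := by
    rw [tendsto_pi_nhds]
    intro i
    have h (c : ℤ) (hc : Odd c) := tendsto_thetaConst_atImInfty hc
    simp only [Avec_eq_thetaConst]
    fin_cases i
    exacts [h 11 (by decide), h 7 (by decide), h 5 (by decide), by simpa using (h 3 (by decide)).neg,
      h 9 (by decide), h 1 (by decide)]
  have h0 : Phi16 0 = 0 := by simpa using Phi16_smul 0 0
  have := (continuous_Phi16.tendsto 0).comp h
  rwa [h0] at this

open scoped UpperHalfPlane MatrixGroups ModularForm in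
lemma Phi16_Avec_slash_T :
    (fun τ : ℍ ↦ Phi16 (Avec τ)) ∣[(8 : ℤ)] ModularGroup.T = fun τ : ℍ ↦ Phi16 (Avec τ) := by
  ext τ
  rw [ModularForm.SL_slash_apply, UpperHalfPlane.modular_T_smul, ModularGroup.denom_apply]
  simp [ModularGroup.T, add_comm (1 : ℂ), Phi16_Avec_add_one]

open scoped UpperHalfPlane MatrixGroups ModularForm in
lemma Phi16_Avec_slash_S :
    (fun τ : ℍ ↦ Phi16 (Avec τ)) ∣[(8 : ℤ)] ModularGroup.S = fun τ : ℍ ↦ Phi16 (Avec τ) := by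
  ext τ
  rw [ModularForm.SL_slash_apply, UpperHalfPlane.modular_S_smul]
  have := τ.ne_zero
  simp [ModularGroup.denom_S, Phi16_Avec_neg_inv τ.im_pos]
  field_simp

open scoped UpperHalfPlane MatrixGroups ModularForm in
/-- The function `Φ16(a1, …, a6)` as a cusp form of weight 8 and level 1. -/
def Phi16CuspForm : CuspForm 𝒮ℒ 8 where
  toFun τ := Phi16 (Avec τ)
  slash_action_eq' _ hγ := by
    obtain ⟨γ, rfl⟩ := hγ
    exact SlashInvariantForm.slash_action_generators_SL2Z Phi16_Avec_slash_S Phi16_Avec_slash_T γ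
  holo' := by
    rw [UpperHalfPlane.mdifferentiable_iff]
    refine .congr (fun z hz ↦ ((differentiable_Phi16 _).comp z
      (differentiableAt_Avec hz)).differentiableWithinAt) fun z hz ↦ ?_
    simp [UpperHalfPlane.ofComplex_apply_of_im_pos hz]
  zero_at_cusps' hc := by
    rw [Subgroup.IsArithmetic.isCusp_iff_isCusp_SL2Z] at hc
    rw [OnePoint.isZeroAt_iff_forall_SL2Z hc]
    intro γ _
    rw [SlashInvariantForm.slash_action_generators_SL2Z Phi16_Avec_slash_S Phi16_Avec_slash_T]
    exact isZeroAtImInfty_Phi16_Avec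

lemma Phi16_Avec_eq_zero {z : ℂ} (hz : 0 < z.im) : Phi16 (Avec z) = 0 := by
  have h := rank_zero_iff.mp
    (CuspForm.rank_eq_zero_of_weight_lt_twelve (k := 8) (by norm_num))
  have h0 : Phi16CuspForm = 0 := Subsingleton.elim _ _
  have := DFunLike.congr_fun h0 ⟨z, hz⟩
  exact this

/-- `Φ16(x1(z),…,x6(z)) = 0` on ℍ. -/
theorem stmt_12 (z : ℂ) (hz : 0 < z.im) : Phi16 (X z) = 0 := by
  rw [show X z = etaF z • Avec z from rfl, Phi16_smul, Phi16_Avec_eq_zero hz, mul_zero]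


end
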